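/- Let D > 0, let y₀ ∈ ℝ² with u := ‖y₀‖ > 0, and let g : (0, ∞) → [0, ∞) be measurable with ∫_{D}^{∞} g(r)·r dr < ∞. Then ∫_{{x ∈ ℝ² : ‖x‖ > D, ‖x − y₀‖ > D}} g(‖x‖) dx = 2π·∫_{D}^{∞} g(r)·r dr − 2·∫_{max(D, u−D)}^{u+D} g(r)·arccos((u² + r² − D²)/(2·u·r))·r dr. -/

import Mathlib

open MeasureTheory Real
open scoped ENNReal

/-- Polar coordinates for a radial integrand over a subset of the exterior of a disk. -/
theorem setLIntegral_radial_eq {D : ℝ} (hD : 0 ≤ D) {g : ℝ → ℝ≥0∞} (hg : Measurable g)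
    {P : Set ℂ} (hP : MeasurableSet P) :
    ∫⁻ z in {z : ℂ | D < ‖z‖} ∩ P, g ‖z‖ =
      ∫⁻ r in Set.Ioi D, g r * ENNReal.ofReal r *
        volume (Set.Ioo (-π) π ∩ {θ | Complex.polarCoord.symm (r, θ) ∈ P}) := by
  have hA : MeasurableSet {z : ℂ | D < ‖z‖} := measurableSet_lt measurable_const measurable_norm
  have hpc : Measurable (fun p : ℝ × ℝ => Complex.polarCoord.symm p) := by
    simp only [Complex.polarCoord_symm_apply]
    fun_prop
  have hF : Measurable (({z : ℂ | D < ‖z‖} ∩ P).indicator (fun z => g ‖z‖)) :=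
    (hg.comp measurable_norm).indicator (hA.inter hP)
  rw [← lintegral_indicator (hA.inter hP), ← Complex.lintegral_comp_polarCoord_symm,
    polarCoord_target, Measure.volume_eq_prod, ← Measure.prod_restrict, lintegral_prod]
  swap
  · refine Measurable.aemeasurable ?_
    simp only [smul_eq_mul]
    exact (ENNReal.measurable_ofReal.comp measurable_fst).mul (hF.comp hpc)
  have hsub : Set.Ioi D ⊆ Set.Ioi 0 := Set.Ioi_subset_Ioi hD
  rw [← Set.inter_eq_self_of_subset_left hsub, ← Measure.restrict_restrict measurableSet_Ioi,
    ← lintegral_indicator (μ := volume.restrict (Set.Ioi 0)) measurableSet_Ioi]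
  refine setLIntegral_congr_fun measurableSet_Ioi fun r (hr : 0 < r) => ?_
  have hm : MeasurableSet {θ : ℝ | Complex.polarCoord.symm (r, θ) ∈ P} :=
    (hpc.comp measurable_prodMk_left) hP
  by_cases h : D < r
  · rw [Set.indicator_of_mem (Set.mem_Ioi.2 h), Set.inter_comm (Set.Ioo _ _), ← Measure.restrict_apply hm,
      ← setLIntegral_const, ← lintegral_indicator hm]
    refine lintegral_congr fun θ => ?_
    by_cases hθ : Complex.polarCoord.symm (r, θ) ∈ P
    · rw [Set.indicator_of_mem, Set.indicator_of_mem (by exact hθ)]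
      · rw [Complex.norm_polarCoord_symm, abs_of_pos hr, smul_eq_mul, mul_comm]
      · exact ⟨by simpa only [Set.mem_ofPred_eq, Complex.norm_polarCoord_symm, abs_of_pos hr], hθ⟩
    · rw [Set.indicator_of_notMem fun hh => hθ hh.2, Set.indicator_of_notMem (by exact hθ),
        smul_zero]
  · rw [Set.indicator_of_notMem (by simpa using h)]
    rw [← lintegral_zero]
    refine lintegral_congr fun θ => ?_
    rw [Set.indicator_of_notMem, smul_zero]
    rintro ⟨hh, -⟩
    exact h (by simpa only [Set.mem_ofPred_eq, Complex.norm_polarCoord_symm, abs_of_pos hr] using hh)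

theorem volume_setOf_le_cos (c : ℝ) :
    volume (Set.Ioo (-π) π ∩ {θ | c ≤ cos θ}) = ENNReal.ofReal (2 * arccos c) := by
  refine le_antisymm ?_ ?_
  · calc _ ≤ volume (Set.Icc (-arccos c) (arccos c)) := by
          refine measure_mono ?_
          rintro θ ⟨⟨h1, h2⟩, h3 : c ≤ cos θ⟩
          rw [Set.mem_Icc, ← abs_le]
          rw [← arccos_cos (abs_nonneg θ) (abs_le.2 ⟨h1.le, h2.le⟩), cos_abs]
          exact arccos_le_arccos h3
      _ = _ := by rw [Real.volume_Icc]; congr 1; ring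
  · calc _ = volume (Set.Ioo (-arccos c) (arccos c)) := by
          rw [Real.volume_Ioo]; congr 1; ring
      _ ≤ _ := by
          refine measure_mono ?_
          rintro θ ⟨h1, h2⟩
          have hπ := arccos_le_pi c
          refine ⟨⟨by linarith, by linarith⟩, ?_⟩
          have habs : |θ| < arccos c := abs_lt.2 ⟨h1, h2⟩
          have hc1 : c < 1 := arccos_pos.1 ((abs_nonneg θ).trans_lt habs)
          show c ≤ cos θ
          rcases le_total c (-1) with hc | hc
          · exact hc.trans (neg_one_le_cos θ)
          · rw [← cos_arccos hc hc1.le, ← cos_abs θ]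
            exact cos_le_cos_of_nonneg_of_le_pi (abs_nonneg θ) hπ habs.le

theorem norm_polarCoord_symm_sub_le_iff {D u r : ℝ} (hD : 0 ≤ D) (hu : 0 < u) (hr : 0 < r)
    (θ : ℝ) : ‖Complex.polarCoord.symm (r, θ) - u‖ ≤ D ↔
      (u ^ 2 + r ^ 2 - D ^ 2) / (2 * u * r) ≤ cos θ := by
  have h : ‖Complex.polarCoord.symm (r, θ) - u‖ ^ 2 = u ^ 2 + r ^ 2 - 2 * u * r * cos θ := by
    rw [Complex.sq_norm, Complex.normSq_apply, Complex.polarCoord_symm_apply]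
    simp [-Complex.ofReal_cos, -Complex.ofReal_sin]
    linear_combination r ^ 2 * sin_sq_add_cos_sq θ
  rw [← sq_le_sq₀ (norm_nonneg _) hD, h, div_le_iff₀ (by positivity)]
  constructor <;> intro h <;> linarith

/-- Every vector of the Euclidean plane is the image of its norm under a linear isometry of `ℂ`. -/
theorem exists_complex_linearIsometryEquiv_apply_norm (y : EuclideanSpace ℝ (Fin 2)) :
    ∃ e : ℂ ≃ₗᵢ[ℝ] EuclideanSpace ℝ (Fin 2), e (‖y‖ : ℂ) = y := by
  let e := Complex.orthonormalBasisOneI.repr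
  refine ⟨(rotation (Circle.exp (e.symm y).arg)).trans e, ?_⟩
  rw [LinearIsometryEquiv.trans_apply, rotation_apply, Circle.coe_exp, ← e.symm.norm_map y,
    mul_comm, Complex.norm_mul_exp_arg_mul_I, e.apply_symm_apply]

/-- For `D > 0`, `y₀ ∈ ℝ²` with `u := ‖y₀‖ > 0`, and measurable
`g : (0,∞) → [0,∞]` with `∫_D^∞ g(r) r dr < ∞`,
`∫_{‖x‖ > D, ‖x - y₀‖ > D} g(‖x‖) dx
  = 2π ∫_D^∞ g(r) r dr - 2 ∫_{max(D, u-D)}^{u+D} g(r) arccos ((u² + r² - D²)/(2 u r)) r dr`. -/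
theorem radial_integral_outside_two_balls
    (D : ℝ) (hD : 0 < D) (y₀ : EuclideanSpace ℝ (Fin 2)) (hu0 : 0 < ‖y₀‖)
    (g : ℝ → ℝ≥0∞) (hg : Measurable g)
    (hfin : ∫⁻ r in Set.Ioi D, g r * ENNReal.ofReal r < ⊤) :
    ∫⁻ x in {x : EuclideanSpace ℝ (Fin 2) | D < ‖x‖ ∧ D < ‖x - y₀‖}, g ‖x‖ =
      ENNReal.ofReal (2 * Real.pi) * (∫⁻ r in Set.Ioi D, g r * ENNReal.ofReal r) -
        2 * ∫⁻ r in Set.Ioc (max D (‖y₀‖ - D)) (‖y₀‖ + D),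
          g r * ENNReal.ofReal
            (Real.arccos ((‖y₀‖ ^ 2 + r ^ 2 - D ^ 2) / (2 * ‖y₀‖ * r)) * r) := by
  obtain ⟨e, he⟩ := exists_complex_linearIsometryEquiv_apply_norm y₀
  generalize ‖y₀‖ = u at *
  have hleft : ∫⁻ x in {x : EuclideanSpace ℝ (Fin 2) | D < ‖x‖ ∧ D < ‖x - y₀‖}, g ‖x‖ =
      ∫⁻ z in {z : ℂ | D < ‖z‖} ∩ {z : ℂ | ‖z - u‖ ≤ D}ᶜ, g ‖z‖ := by
    rw [← e.measurePreserving.setLIntegral_comp_preimage_emb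
      e.toHomeomorph.measurableEmbedding]
    simp only [LinearIsometryEquiv.norm_map]
    congr 2
    ext z
    simp [← he, ← map_sub]
  have hball : MeasurableSet {z : ℂ | ‖z - u‖ ≤ D} :=
    measurableSet_le (by fun_prop) measurable_const
  have htotal : ∫⁻ z in {z : ℂ | D < ‖z‖}, g ‖z‖ =
      ENNReal.ofReal (2 * π) * ∫⁻ r in Set.Ioi D, g r * ENNReal.ofReal r := by
    have h := setLIntegral_radial_eq hD.le hg (P := Set.univ) MeasurableSet.univ
    simp only [Set.inter_univ, Set.mem_univ, Set.ofPred_true, Real.volume_Ioo] at h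
    rw [h, lintegral_mul_const _ (by fun_prop), mul_comm]
    congr 2
    ring
  have hinner : ∫⁻ z in {z : ℂ | D < ‖z‖} ∩ {z : ℂ | ‖z - u‖ ≤ D}, g ‖z‖ =
      2 * ∫⁻ r in Set.Ioc (max D (u - D)) (u + D),
        g r * ENNReal.ofReal (arccos ((u ^ 2 + r ^ 2 - D ^ 2) / (2 * u * r)) * r) := by
    have hsub : Set.Ioc (max D (u - D)) (u + D) ⊆ Set.Ioi D := fun r hr =>
      (le_max_left _ _).trans_lt hr.1
    rw [setLIntegral_radial_eq hD.le hg hball, ← lintegral_const_mul' _ _ (by simp),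
      ← Set.inter_eq_self_of_subset_left hsub, ← Measure.restrict_restrict measurableSet_Ioc,
      ← lintegral_indicator (μ := volume.restrict (Set.Ioi D)) measurableSet_Ioc]
    have hne : ∀ᵐ r ∂volume.restrict (Set.Ioi D), r ≠ u - D :=
      ae_restrict_of_ae (Measure.ae_ne volume (u - D))
    refine lintegral_congr_ae ?_
    filter_upwards [hne, ae_restrict_mem measurableSet_Ioi] with r hr' (hr : D < r)
    have hr0 : 0 < r := hD.trans hr
    simp only [norm_polarCoord_symm_sub_le_iff hD.le hu0 hr0,
      volume_setOf_le_cos]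
    by_cases h : r ∈ Set.Ioc (max D (u - D)) (u + D)
    · rw [Set.indicator_of_mem h, ENNReal.ofReal_mul zero_le_two,
        ENNReal.ofReal_mul (arccos_nonneg _), ENNReal.ofReal_ofNat]
      ring
    · rw [Set.indicator_of_notMem h, arccos_eq_zero.2, mul_zero, ENNReal.ofReal_zero, mul_zero]
      rw [le_div_iff₀ (by positivity)]
      have hcase : D ≤ |u - r| := by
        by_contra! hlt
        rw [abs_lt] at hlt
        exact h ⟨max_lt hr (by linarith), by linarith⟩
      nlinarith [sq_le_sq' (by linarith [abs_nonneg (u - r)]) hcase, sq_abs (u - r)]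
  have hsplit := lintegral_inter_add_sdiff (μ := volume) (fun z : ℂ => g ‖z‖)
    {z : ℂ | D < ‖z‖} hball
  rw [hleft, ← htotal, ← hinner, ← hsplit, Set.sdiff_eq]
  refine (ENNReal.add_sub_cancel_left (ne_top_of_le_ne_top ?_
    (lintegral_mono_set Set.inter_subset_left))).symm
  rw [htotal]
  exact ENNReal.mul_ne_top ENNReal.ofReal_ne_top hfin.ne
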